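/- arXiv:1601.08194 — 3 statements merged into one kernel-verified Lean document; each statement's English description precedes it below -/
import Mathlib

section
/- Let S be an inverse semigroup. For the normal inverse subsemigroup N = S, the relation ≤_S coincides with Green's J-preorder on S: for all s, t ∈ S, s ≤_S t if and only if there exists p ∈ S with p p⁻¹ ≤ t t⁻¹ and p⁻¹ p = s s⁻¹ (equivalently, the principal two-sided ideal generated by s is contained in that generated by t). -/
/-- An inverse semigroup: a semigroup in which every element `s` has a
(unique) inverse `s⁻¹` with `s * s⁻¹ * s = s` and `s⁻¹ * s * s⁻¹ = s⁻¹`. -/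
class InverseSemigroup (S : Type*) extends Semigroup S, Inv S where
  mul_inv_mul : ∀ s : S, s * s⁻¹ * s = s
  inv_mul_inv : ∀ s : S, s⁻¹ * s * s⁻¹ = s⁻¹
  inv_unique : ∀ s t : S, s * t * s = s → t * s * t = t → t = s⁻¹

/-- The natural partial order on an inverse semigroup:
`s ≤ t` iff `s = e * t` for some idempotent `e`. -/
def NatLe {S : Type*} [InverseSemigroup S] (s t : S) : Prop :=
  ∃ e : S, IsIdempotentElem e ∧ s = e * t

/-- A normal inverse subsemigroup: a full inverse subsemigroup that is
closed under conjugation. -/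
structure IsNormalInverseSubsemigroup {S : Type*} [InverseSemigroup S] (N : Set S) : Prop where
  mul_mem : ∀ {a b : S}, a ∈ N → b ∈ N → a * b ∈ N
  inv_mem : ∀ {a : S}, a ∈ N → a⁻¹ ∈ N
  full : ∀ {e : S}, IsIdempotentElem e → e ∈ N
  conj_mem : ∀ (s : S) {n : S}, n ∈ N → s⁻¹ * n * s ∈ N

/-- The preorder `≤_N` associated to a normal inverse subsemigroup `N`:
`s ≤_N t` iff there are `a, b ∈ N` with `a⁻¹ * a = s * s⁻¹`,
`s⁻¹ * s = b * b⁻¹` (so `a · s · b` is a trace product) and `a * s * b ≤ t`. -/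
def LeN {S : Type*} [InverseSemigroup S] (N : Set S) (s t : S) : Prop :=
  ∃ a ∈ N, ∃ b ∈ N, a⁻¹ * a = s * s⁻¹ ∧ s⁻¹ * s = b * b⁻¹ ∧ NatLe (a * s * b) t

/-- The equivalence `≃_N` obtained by symmetrizing `≤_N`. -/
def SimeqN {S : Type*} [InverseSemigroup S] (N : Set S) (s t : S) : Prop :=
  LeN N s t ∧ LeN N t s

namespace InverseSemigroup

variable {S : Type*} [InverseSemigroup S]

protected theorem inv_inv (s : S) : s⁻¹⁻¹ = s :=
  (inv_unique s⁻¹ s (inv_mul_inv s) (mul_inv_mul s)).symm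

theorem isIdempotentElem_mul_inv (s : S) : IsIdempotentElem (s * s⁻¹) := by
  rw [IsIdempotentElem, ← mul_assoc, mul_inv_mul]

theorem isIdempotentElem_inv_mul (s : S) : IsIdempotentElem (s⁻¹ * s) := by
  rw [IsIdempotentElem, ← mul_assoc, inv_mul_inv]

theorem inv_eq_self_of_isIdempotentElem {e : S} (he : IsIdempotentElem e) : e⁻¹ = e := by
  have h : e * e * e = e := by rw [he.eq, he.eq]
  exact (inv_unique e e h h).symm

theorem isIdempotentElem_mul {e f : S} (he : IsIdempotentElem e) (hf : IsIdempotentElem f) :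
    IsIdempotentElem (e * f) := by
  have hx := inv_mul_inv (e * f)
  have h : f * (e * f)⁻¹ * e = (e * f)⁻¹ := by
    refine inv_unique _ _ ?_ ?_
    · calc e * f * (f * (e * f)⁻¹ * e) * (e * f)
          = e * (f * f) * (e * f)⁻¹ * (e * e * f) := by simp only [mul_assoc]
        _ = e * f := by rw [he.eq, hf.eq, mul_inv_mul]
    · calc f * (e * f)⁻¹ * e * (e * f) * (f * (e * f)⁻¹ * e)
          = f * ((e * f)⁻¹ * (e * e * (f * f)) * (e * f)⁻¹) * e := by simp only [mul_assoc]
        _ = f * (e * f)⁻¹ * e := by rw [he.eq, hf.eq, hx]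
  have hi : IsIdempotentElem (e * f)⁻¹ := by
    calc (e * f)⁻¹ * (e * f)⁻¹
        = f * (e * f)⁻¹ * e * (f * (e * f)⁻¹ * e) := by rw [h]
      _ = f * ((e * f)⁻¹ * (e * f) * (e * f)⁻¹) * e := by simp only [mul_assoc]
      _ = (e * f)⁻¹ := by rw [hx, h]
  have hinv := inv_eq_self_of_isIdempotentElem hi
  rw [InverseSemigroup.inv_inv] at hinv
  rwa [← hinv] at hi

theorem mul_comm_of_isIdempotentElem {e f : S} (he : IsIdempotentElem e)
    (hf : IsIdempotentElem f) : e * f = f * e := by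
  have key : ∀ {e f : S}, IsIdempotentElem e → IsIdempotentElem f →
      e * f * (f * e) * (e * f) = e * f := fun {e f} he hf => by
    calc e * f * (f * e) * (e * f)
        = e * (f * f) * (e * e * f) := by simp only [mul_assoc]
      _ = e * f := by rw [he.eq, hf.eq, (isIdempotentElem_mul he hf).eq]
  rw [inv_unique (e * f) (f * e) (key he hf) (key hf he),
    inv_eq_self_of_isIdempotentElem (isIdempotentElem_mul he hf)]

protected theorem mul_inv_rev (a b : S) : (a * b)⁻¹ = b⁻¹ * a⁻¹ := by
  have hc := mul_comm_of_isIdempotentElem (isIdempotentElem_mul_inv b) (isIdempotentElem_inv_mul a)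
  refine (inv_unique _ _ ?_ ?_).symm
  · calc a * b * (b⁻¹ * a⁻¹) * (a * b)
        = a * (b * b⁻¹ * (a⁻¹ * a)) * b := by simp only [mul_assoc]
      _ = a * a⁻¹ * a * (b * b⁻¹ * b) := by rw [hc]; simp only [mul_assoc]
      _ = a * b := by rw [mul_inv_mul, mul_inv_mul]
  · calc b⁻¹ * a⁻¹ * (a * b) * (b⁻¹ * a⁻¹)
        = b⁻¹ * (a⁻¹ * a * (b * b⁻¹)) * a⁻¹ := by simp only [mul_assoc]
      _ = b⁻¹ * b * b⁻¹ * (a⁻¹ * a * a⁻¹) := by rw [← hc]; simp only [mul_assoc]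
      _ = b⁻¹ * a⁻¹ := by rw [inv_mul_inv, inv_mul_inv]

end InverseSemigroup

open InverseSemigroup in
/-- The natural partial order is preserved by `s ↦ s * s⁻¹`. -/
theorem NatLe.mul_inv {S : Type*} [InverseSemigroup S] {s t : S} (h : NatLe s t) :
    NatLe (s * s⁻¹) (t * t⁻¹) := by
  obtain ⟨e, he, rfl⟩ := h
  refine ⟨e, he, ?_⟩
  calc e * t * (e * t)⁻¹
      = e * (t * t⁻¹ * e) := by
        rw [InverseSemigroup.mul_inv_rev, inv_eq_self_of_isIdempotentElem he]
        simp only [mul_assoc]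
    _ = e * e * (t * t⁻¹) := by
        rw [mul_comm_of_isIdempotentElem (isIdempotentElem_mul_inv t) he, mul_assoc]
    _ = e * (t * t⁻¹) := by rw [he.eq]

/-- For `N = S`, the relation `≤_S` is Green's `J`-preorder on `S`. -/
theorem leN_univ_iff_J_preorder {S : Type*} [InverseSemigroup S] (s t : S) :
    LeN (Set.univ : Set S) s t ↔
      ∃ p : S, NatLe (p * p⁻¹) (t * t⁻¹) ∧ p⁻¹ * p = s * s⁻¹ := by
  constructor
  · rintro ⟨a, -, b, -, ha, hb, h⟩
    refine ⟨a, ?_, ha⟩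
    have hr : a * s * b * (a * s * b)⁻¹ = a * a⁻¹ := by
      calc a * s * b * (a * s * b)⁻¹
          = a * s * (b * b⁻¹) * s⁻¹ * a⁻¹ := by
            simp only [InverseSemigroup.mul_inv_rev, mul_assoc]
        _ = a * (s * s⁻¹ * s * s⁻¹) * a⁻¹ := by rw [← hb]; simp only [mul_assoc]
        _ = a * a⁻¹ * a * a⁻¹ := by
            rw [InverseSemigroup.mul_inv_mul, ← ha]; simp only [mul_assoc]
        _ = a * a⁻¹ := by rw [InverseSemigroup.mul_inv_mul]
    exact hr ▸ h.mul_inv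
  · rintro ⟨p, ⟨f, -, hf⟩, hp⟩
    have hpt : p * p⁻¹ * (t * t⁻¹) = p * p⁻¹ := by
      rw [hf, mul_assoc, (InverseSemigroup.isIdempotentElem_mul_inv t).eq]
    refine ⟨p, trivial, s⁻¹ * p⁻¹ * t, trivial, hp, ?_, p * p⁻¹,
      InverseSemigroup.isIdempotentElem_mul_inv p, ?_⟩
    · symm
      calc s⁻¹ * p⁻¹ * t * (s⁻¹ * p⁻¹ * t)⁻¹
          = s⁻¹ * p⁻¹ * (t * t⁻¹) * p * s := by
            simp only [InverseSemigroup.mul_inv_rev, InverseSemigroup.inv_inv, mul_assoc]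
        _ = s⁻¹ * (p⁻¹ * (p * p⁻¹ * (t * t⁻¹))) * p * s := by
            conv_lhs => rw [← InverseSemigroup.inv_mul_inv p]
            simp only [mul_assoc]
        _ = s⁻¹ * (p⁻¹ * p * p⁻¹ * p) * s := by rw [hpt]; simp only [mul_assoc]
        _ = s⁻¹ * s * s⁻¹ * s := by
            rw [InverseSemigroup.inv_mul_inv, hp]; simp only [mul_assoc]
        _ = s⁻¹ * s := by rw [InverseSemigroup.inv_mul_inv]
    · calc p * s * (s⁻¹ * p⁻¹ * t)
          = p * (s * s⁻¹) * p⁻¹ * t := by simp only [mul_assoc]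
        _ = p * p⁻¹ * p * p⁻¹ * t := by rw [← hp]; simp only [mul_assoc]
        _ = p * p⁻¹ * t := by rw [InverseSemigroup.mul_inv_mul]
end

section
/- Let S be an inverse semigroup and N a normal inverse subsemigroup of S. If s, t ∈ S satisfy s ≤_N t, then s t⁻¹ ∈ N. -/
/-- Inversion in an inverse semigroup is involutive. -/
theorem InverseSemigroup.inv_inv_s5 {S : Type*} [InverseSemigroup S] (s : S) : s⁻¹⁻¹ = s :=
  (inv_unique s⁻¹ s (inv_mul_inv s) (mul_inv_mul s)).symm

/-- If `s ≤_N t` then `s * t⁻¹ ∈ N`. -/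
theorem leN_imp_mul_inv_mem {S : Type*} [InverseSemigroup S] {N : Set S}
    (hN : IsNormalInverseSubsemigroup N) {s t : S} (h : LeN N s t) :
    s * t⁻¹ ∈ N := by
  obtain ⟨a, ha, b, hb, hab, hsb, e, he, hst⟩ := h
  have hs : s = a⁻¹ * (e * t) * b⁻¹ := by
    calc s = s * s⁻¹ * s * s⁻¹ * s := by simp only [InverseSemigroup.mul_inv_mul]
      _ = a⁻¹ * a * s * (s⁻¹ * s) := by rw [hab]; simp only [mul_assoc]
      _ = a⁻¹ * (a * s * b) * b⁻¹ := by rw [hsb]; simp only [mul_assoc]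
      _ = a⁻¹ * (e * t) * b⁻¹ := by rw [hst]
  have hconj : t * b⁻¹ * t⁻¹ ∈ N := by
    simpa only [InverseSemigroup.inv_inv_s5] using hN.conj_mem t⁻¹ (hN.inv_mem hb)
  have hmem := hN.mul_mem (hN.mul_mem (hN.inv_mem ha) (hN.full he)) hconj
  rw [hs]
  simpa only [mul_assoc] using hmem
end

section
/- Let S be an inverse semigroup. The assignment N ↦ ≤_N is an order-preserving embedding of the poset of normal inverse subsemigroups of S (ordered by inclusion) into the poset of preorders on S containing the natural partial order: for normal inverse subsemigroups N and M of S, N = { s ∈ S : there exists e ∈ E(S) with s ≤_N e }, so if ≤_N = ≤_M then N = M, and if N ⊆ M then s ≤_N t implies s ≤_M t for all s, t ∈ S. -/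
theorem LeN.mono {S : Type*} [InverseSemigroup S] {N M : Set S} (hNM : N ⊆ M) {s t : S}
    (h : LeN N s t) : LeN M s t := by
  obtain ⟨a, ha, b, hb, h⟩ := h
  exact ⟨a, hNM ha, b, hNM hb, h⟩

namespace IsNormalInverseSubsemigroup

open InverseSemigroup

variable {S : Type*} [InverseSemigroup S] {N : Set S}

theorem leN_inv_mul_self (hN : IsNormalInverseSubsemigroup N) {s : S} (hs : s ∈ N) :
    LeN N s (s⁻¹ * s) := by
  have he := isIdempotentElem_inv_mul s
  refine ⟨s⁻¹, hN.inv_mem hs, s⁻¹ * s, hN.full he, ?_, ?_, s⁻¹ * s, he, rfl⟩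
  · rw [InverseSemigroup.inv_inv]
  · rw [inv_eq_self_of_isIdempotentElem he, he.eq]

theorem mem_of_leN (hN : IsNormalInverseSubsemigroup N) {s t : S} (ht : t ∈ N)
    (h : LeN N s t) : s ∈ N := by
  obtain ⟨a, ha, b, hb, hl, hr, f, hf, hle⟩ := h
  have key : a⁻¹ * (a * s * b) * b⁻¹ = s := by
    calc a⁻¹ * (a * s * b) * b⁻¹ = a⁻¹ * a * s * (b * b⁻¹) := by simp only [mul_assoc]
      _ = s := by rw [hl, ← hr, mul_inv_mul, ← mul_assoc, mul_inv_mul]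
  rw [← key, hle]
  exact hN.mul_mem (hN.mul_mem (hN.inv_mem ha) (hN.mul_mem (hN.full hf) ht)) (hN.inv_mem hb)

theorem eq_setOf_leN (hN : IsNormalInverseSubsemigroup N) :
    N = {s : S | ∃ e : S, IsIdempotentElem e ∧ LeN N s e} := by
  ext s
  constructor
  · intro hs
    exact ⟨s⁻¹ * s, isIdempotentElem_inv_mul s, hN.leN_inv_mul_self hs⟩
  · rintro ⟨e, he, h⟩
    exact hN.mem_of_leN (hN.full he) h

end IsNormalInverseSubsemigroup

/-- The assignment `N ↦ ≤_N` is an order-preserving embedding of the poset of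
normal inverse subsemigroups of `S` into the poset of preorders on `S`
containing the natural partial order: `N` is recovered from `≤_N`, the
assignment is injective, and it is order-preserving. -/
theorem normal_subsemigroup_embedding {S : Type*} [InverseSemigroup S] :
    (∀ N : Set S, IsNormalInverseSubsemigroup N →
      N = {s : S | ∃ e : S, IsIdempotentElem e ∧ LeN N s e}) ∧
    (∀ N M : Set S, IsNormalInverseSubsemigroup N → IsNormalInverseSubsemigroup M →
      LeN N = LeN M → N = M) ∧
    (∀ N M : Set S, IsNormalInverseSubsemigroup N → IsNormalInverseSubsemigroup M →
      N ⊆ M → ∀ s t : S, LeN N s t → LeN M s t) := by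
  refine ⟨fun N hN => hN.eq_setOf_leN, fun N M hN hM h => ?_, fun N M _ _ hNM s t => LeN.mono hNM⟩
  exact hN.eq_setOf_leN.trans (h ▸ hM.eq_setOf_leN.symm)
end
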